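/- arXiv:1506.07488 — 3 statements merged into one kernel-verified Lean document; each statement's English description precedes it below -/
import Mathlib

section
/- Let 0 < u < 1. Then, as ε → 0+, ⟨f⁽¹⁾_{ε,u}, f⁽¹⁾_{ε,u}⟩ = −(1/π²)·(log ε − κ − log u) + O(ε); precisely, there exist constants C > 0 and ε₀ > 0 (depending on φ and u) such that for all 0 < ε < ε₀ one has |⟨f⁽¹⁾_{ε,u}, f⁽¹⁾_{ε,u}⟩ + (1/π²)·(log ε − κ − log u)| ≤ C·ε. -/
open MeasureTheory Real Set

/-- The scalar product ⟨f,g⟩ = −(1/(2π²)) ∬ f′(x) g′(y) log|x−y| dx dy. -/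
noncomputable def scalarProd (f g : ℝ → ℝ) : ℝ :=
  -(1 / (2 * π ^ 2)) * ∫ x : ℝ, ∫ y : ℝ, deriv f x * deriv g y * Real.log |x - y|

/-- κ = −∬ φ(x) φ(y) log|x−y| dx dy. -/
noncomputable def kappa (φ : ℝ → ℝ) : ℝ :=
  -∫ x : ℝ, ∫ y : ℝ, φ x * φ y * Real.log |x - y|

/-- The smoothed indicator function χ_J ⋆ φ_ε, where φ_ε(x) = ε⁻¹ φ(x/ε). -/
noncomputable def smoothedInd (φ : ℝ → ℝ) (ε : ℝ) (J : Set ℝ) (x : ℝ) : ℝ :=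
  ∫ y : ℝ, J.indicator (fun _ => (1 : ℝ)) (x - y) * (ε⁻¹ * φ (y / ε))

/-- The bilinear form `∬ g(x) h(y) k(x - y) dx dy` with kernel `k`. -/
noncomputable def kernelForm (k g h : ℝ → ℝ) : ℝ :=
  ∫ x : ℝ, ∫ y : ℝ, g x * h y * k (x - y)

section kernelForm

variable {k k' g g' h h' : ℝ → ℝ}

lemma integrable_mul_kernel (hk : LocallyIntegrable k) (hh : Continuous h)
    (hhc : HasCompactSupport h) (x : ℝ) : Integrable fun y => h y * k (x - y) :=
  hhc.convolutionExists_left (ContinuousLinearMap.mul ℝ ℝ) hh hk x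

lemma continuous_potential (hk : LocallyIntegrable k) (hh : Continuous h)
    (hhc : HasCompactSupport h) : Continuous fun x => ∫ y, h y * k (x - y) :=
  hhc.continuous_convolution_left (ContinuousLinearMap.mul ℝ ℝ) hh hk

lemma kernelForm_eq (k g h : ℝ → ℝ) :
    kernelForm k g h = ∫ x, g x * ∫ y, h y * k (x - y) := by
  simp only [kernelForm, mul_assoc, integral_const_mul]

lemma integrable_mul_potential (hk : LocallyIntegrable k) (hg : Continuous g)
    (hgc : HasCompactSupport g) (hh : Continuous h) (hhc : HasCompactSupport h) :
    Integrable fun x => g x * ∫ y, h y * k (x - y) :=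
  (hg.mul (continuous_potential hk hh hhc)).integrable_of_hasCompactSupport hgc.mul_right

lemma kernelForm_sub_left (hk : LocallyIntegrable k) (hg : Continuous g)
    (hgc : HasCompactSupport g) (hg' : Continuous g') (hgc' : HasCompactSupport g')
    (hh : Continuous h) (hhc : HasCompactSupport h) :
    kernelForm k (fun x => g x - g' x) h = kernelForm k g h - kernelForm k g' h := by
  simp only [kernelForm_eq, sub_mul]
  exact integral_sub (integrable_mul_potential hk hg hgc hh hhc)
    (integrable_mul_potential hk hg' hgc' hh hhc)

lemma kernelForm_sub_right (hk : LocallyIntegrable k) (hg : Continuous g)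
    (hgc : HasCompactSupport g) (hh : Continuous h) (hhc : HasCompactSupport h)
    (hh' : Continuous h') (hhc' : HasCompactSupport h') :
    kernelForm k g (fun y => h y - h' y) = kernelForm k g h - kernelForm k g h' := by
  simp only [kernelForm_eq, sub_mul]
  rw [← integral_sub (integrable_mul_potential hk hg hgc hh hhc)
    (integrable_mul_potential hk hg hgc hh' hhc')]
  congr 1 with x
  rw [integral_sub (integrable_mul_kernel hk hh hhc x) (integrable_mul_kernel hk hh' hhc' x),
    mul_sub]

lemma kernelForm_sub_const (hk : LocallyIntegrable k) (hg : Continuous g)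
    (hgc : HasCompactSupport g) (hh : Continuous h) (hhc : HasCompactSupport h) (c : ℝ) :
    kernelForm (fun w => k w - c) g h = kernelForm k g h - c * ((∫ x, g x) * ∫ y, h y) := by
  have hgi := hg.integrable_of_hasCompactSupport (μ := volume) hgc
  have hhi := hh.integrable_of_hasCompactSupport (μ := volume) hhc
  have inner (x : ℝ) : ∫ y, h y * (k (x - y) - c) = (∫ y, h y * k (x - y)) - (∫ y, h y) * c := by
    simp only [mul_sub]
    rw [integral_sub (integrable_mul_kernel hk hh hhc x) (hhi.mul_const c), integral_mul_const]
  simp only [kernelForm_eq, inner]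
  simp only [mul_sub]
  rw [integral_sub (integrable_mul_potential hk hg hgc hh hhc) (hgi.mul_const _),
    integral_mul_const]
  ring

lemma kernelForm_congr_ae (hkk : k =ᵐ[volume] k') : kernelForm k g h = kernelForm k' g h := by
  unfold kernelForm
  congr 1 with x
  refine integral_congr_ae ?_
  have := (quasiMeasurePreserving_sub_left volume x).ae_eq_comp hkk
  filter_upwards [this] with y hy
  simp only [Function.comp] at hy
  rw [hy]

lemma abs_kernelForm_le (hg : Integrable g) (hh : Integrable h) {K : ℝ}
    (hK : ∀ x y, g x ≠ 0 → h y ≠ 0 → |k (x - y)| ≤ K) :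
    |kernelForm k g h| ≤ K * ((∫ x, |g x|) * ∫ y, |h y|) := by
  have pointwise (x y : ℝ) : |g x * h y * k (x - y)| ≤ |g x| * |h y| * K := by
    by_cases hx : g x = 0
    · simp [hx]
    by_cases hy : h y = 0
    · simp [hy]
    rw [abs_mul, abs_mul]
    gcongr
    exact hK x y hx hy
  have inner (x : ℝ) : |∫ y, g x * h y * k (x - y)| ≤ |g x| * ((∫ y, |h y|) * K) := by
    have := norm_integral_le_of_norm_le (f := fun y => g x * h y * k (x - y))
      ((hh.abs.const_mul |g x|).mul_const K) (.of_forall (pointwise x))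
    rwa [integral_mul_const, integral_const_mul, mul_assoc] at this
  have := norm_integral_le_of_norm_le (f := fun x => ∫ y, g x * h y * k (x - y))
    (hg.abs.mul_const _) (.of_forall inner)
  rw [integral_mul_const] at this
  calc |kernelForm k g h| ≤ _ := this
    _ = _ := by ring

end kernelForm

lemma integral_rescale_translate {ε : ℝ} (hε : 0 < ε) (a : ℝ) (φ F : ℝ → ℝ) :
    ∫ x, ε⁻¹ * φ ((x - a) / ε) * F x = ∫ s, φ s * F (ε * s + a) := by
  have h1 := integral_sub_right_eq_self (μ := volume)
    (fun x => ε⁻¹ * φ (x / ε) * F (x + a)) a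
  have h2 := Measure.integral_comp_div (fun s => ε⁻¹ * φ s * F (ε * s + a)) ε
  simp only [sub_add_cancel, mul_div_cancel₀ _ hε.ne'] at h1 h2
  rw [h1, h2, abs_of_pos hε, smul_eq_mul, ← integral_const_mul]
  congr 1 with s
  field_simp

lemma kernelForm_rescale_translate {ε : ℝ} (hε : 0 < ε) (a b : ℝ) (k φ : ℝ → ℝ) :
    kernelForm k (fun x => ε⁻¹ * φ ((x - a) / ε)) (fun y => ε⁻¹ * φ ((y - b) / ε)) =
      kernelForm (fun w => k (ε * w + (a - b))) φ φ := by
  simp only [kernelForm_eq]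
  rw [integral_rescale_translate hε a φ fun x => ∫ y, ε⁻¹ * φ ((y - b) / ε) * k (x - y)]
  congr 1 with s
  rw [integral_rescale_translate hε b φ fun y => k (ε * s + a - y)]
  congr 3 with t
  congr 2
  ring

lemma locallyIntegrable_log_abs_affine {c : ℝ} (hc : c ≠ 0) (d : ℝ) :
    LocallyIntegrable fun x : ℝ => Real.log |c * x + d| := by
  rw [locallyIntegrable_iff]
  intro K hK
  obtain ⟨R, hR⟩ := hK.isBounded.subset_closedBall 0
  rw [Real.closedBall_eq_Icc] at hR
  refine IntegrableOn.mono_set ?_ hR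
  simp only [Real.log_abs]
  by_cases hR0 : 0 ≤ R
  · rw [← intervalIntegrable_iff_integrableOn_Icc_of_le (by linarith)]
    have h := (intervalIntegral.intervalIntegrable_log' (a := c * (0 - R) + d)
      (b := c * (0 + R) + d)).comp_add_right d
    have h' := h.comp_mul_left (c := c)
    have e (z : ℝ) : (c * z + d - d) / c = z := by field_simp; ring
    simpa only [e, zero_sub, zero_add] using h'
  · rw [Set.Icc_eq_empty (by linarith)]
    exact integrableOn_empty

lemma deriv_smoothedInd_Icc {φ : ℝ → ℝ} (hφ : Continuous φ) (ε : ℝ) {u : ℝ} (hu : 0 ≤ u) (x : ℝ) :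
    deriv (smoothedInd φ ε (Set.Icc 0 u)) x =
      ε⁻¹ * φ ((x - 0) / ε) - ε⁻¹ * φ ((x - u) / ε) := by
  set ψ : ℝ → ℝ := fun y => ε⁻¹ * φ (y / ε) with hψ
  have hψc : Continuous ψ := by fun_prop
  have key : smoothedInd φ ε (Set.Icc 0 u) =
      fun x => (∫ y in (0 : ℝ)..x, ψ y) - ∫ y in (0 : ℝ)..(x - u), ψ y := by
    funext x
    rw [intervalIntegral.integral_interval_sub_left (hψc.intervalIntegrable _ _)
      (hψc.intervalIntegrable _ _), intervalIntegral.integral_of_le (by linarith),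
      ← integral_Icc_eq_integral_Ioc, ← integral_indicator measurableSet_Icc]
    unfold smoothedInd
    congr 1 with y
    by_cases hy : y ∈ Set.Icc (x - u) x
    · have : x - y ∈ Set.Icc 0 u := ⟨by linarith [hy.2], by linarith [hy.1]⟩
      simp [hy, this, hψ]
    · have : x - y ∉ Set.Icc 0 u := fun h => hy ⟨by linarith [h.2], by linarith [h.1]⟩
      simp [hy, this]
  have hd (z : ℝ) : HasDerivAt (fun x => ∫ y in (0 : ℝ)..x, ψ y) (ψ z) z :=
    hψc.integral_hasStrictDerivAt 0 z |>.hasDerivAt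
  have h := ((hd x).sub ((hd (x - u)).comp_sub_const x u)).deriv
  rw [key, sub_zero]
  exact h

lemma abs_log_abs_sub_log_le {u t d : ℝ} (hu : 0 < u) (hd : |d| = u) (ht : |t| ≤ u / 2) :
    |Real.log |t + d| - Real.log u| ≤ 2 / u * |t| := by
  have hv : |(|t + d| - u)| ≤ |t| := by
    have := abs_abs_sub_abs_le_abs_sub (t + d) d
    rwa [hd, add_sub_cancel_right] at this
  have hv' := abs_le.1 hv
  set v := |t + d|
  have hv0 : 0 < v := by linarith
  have hb : 0 ≤ |t| := abs_nonneg t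
  rw [← Real.log_div hv0.ne' hu.ne', abs_le]
  constructor
  · have h := Real.one_sub_inv_le_log_of_pos (div_pos hv0 hu)
    refine le_trans ?_ h
    rw [inv_div, le_sub_iff_add_le, ← le_sub_iff_add_le', div_le_iff₀ hv0]
    have : (1 - -(2 / u * |t|)) * v - u = (v - u + |t|) + |t| * (2 * v - u) / u := by
      field_simp
      ring
    have h2 : 0 ≤ |t| * (2 * v - u) / u :=
      div_nonneg (mul_nonneg hb (by linarith)) hu.le
    linarith
  · refine (Real.log_le_sub_one_of_pos (div_pos hv0 hu)).trans ?_
    rw [div_sub_one hu.ne', div_mul_eq_mul_div]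
    gcongr
    linarith

theorem stmt_1 (φ : ℝ → ℝ) (hφ : ContDiff ℝ (⊤ : ℕ∞) φ)
    (hsupp : Function.support φ ⊆ Set.Ioo (-(1/2)) (1/2))
    (hnorm : ∫ x : ℝ, φ x = 1)
    (u : ℝ) (hu0 : 0 < u) (hu1 : u < 1) :
    ∃ C > 0, ∃ ε₀ > 0, ∀ ε : ℝ, 0 < ε → ε < ε₀ →
      |scalarProd (smoothedInd φ ε (Set.Icc 0 u)) (smoothedInd φ ε (Set.Icc 0 u)) +
        (1 / π ^ 2) * (Real.log ε - kappa φ - Real.log u)| ≤ C * ε := by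
  have hc : Continuous φ := hφ.continuous
  have hcs : HasCompactSupport φ :=
    HasCompactSupport.of_support_subset_isCompact isCompact_Icc (hsupp.trans Ioo_subset_Icc_self)
  have hint : Integrable φ := hc.integrable_of_hasCompactSupport hcs
  have hlog : LocallyIntegrable fun w : ℝ => Real.log |w| := by
    simpa using locallyIntegrable_log_abs_affine one_ne_zero 0
  have hM : 0 ≤ ∫ x, |φ x| := integral_nonneg fun x => abs_nonneg _
  set M := ∫ x, |φ x|
  refine ⟨1 / (2 * π ^ 2) * (4 / u * (M * M)) + 1, by positivity, u / 2, by positivity, ?_⟩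
  intro ε hε hεu
  have hg (a : ℝ) : Continuous fun x => ε⁻¹ * φ ((x - a) / ε) := by fun_prop
  have hgc (a : ℝ) : HasCompactSupport fun x => ε⁻¹ * φ ((x - a) / ε) := by
    refine HasCompactSupport.mul_left ?_
    have h := hcs.comp_homeomorph
      ((Homeomorph.subRight a).trans (Homeomorph.mulRight₀ ε⁻¹ (inv_ne_zero hε.ne')))
    simpa [Function.comp_def, div_eq_mul_inv] using h
  have hdiff : Continuous fun x => ε⁻¹ * φ ((x - 0) / ε) - ε⁻¹ * φ ((x - u) / ε) :=
    (hg 0).sub (hg u)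
  have hdiffc : HasCompactSupport fun x => ε⁻¹ * φ ((x - 0) / ε) - ε⁻¹ * φ ((x - u) / ε) :=
    (hgc 0).sub (hgc u)
  have hscalar : scalarProd (smoothedInd φ ε (Set.Icc 0 u)) (smoothedInd φ ε (Set.Icc 0 u)) =
      -(1 / (2 * π ^ 2)) * kernelForm (fun w => Real.log |w|)
        (fun x => ε⁻¹ * φ ((x - 0) / ε) - ε⁻¹ * φ ((x - u) / ε))
        (fun x => ε⁻¹ * φ ((x - 0) / ε) - ε⁻¹ * φ ((x - u) / ε)) := by
    simp only [scalarProd, kernelForm, deriv_smoothedInd_Icc hc ε hu0.le]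
  have hdiag : kernelForm (fun w => Real.log |ε * w + 0|) φ φ = Real.log ε - kappa φ := by
    have hae : (fun w => Real.log |ε * w + 0|) =ᵐ[volume]
        fun w => Real.log |w| - -Real.log ε := by
      filter_upwards [Measure.ae_ne volume (0 : ℝ)] with w hw
      rw [add_zero, abs_mul, abs_of_pos hε, Real.log_mul hε.ne' (abs_ne_zero.2 hw)]
      ring
    rw [kernelForm_congr_ae hae, kernelForm_sub_const hlog hc hcs hc hcs, hnorm]
    simp only [kernelForm, kappa]
    ring
  have hoff (d : ℝ) (hd : |d| = u) :
      |kernelForm (fun w => Real.log |ε * w + d|) φ φ - Real.log u| ≤ 2 / u * ε * (M * M) := by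
    have h := kernelForm_sub_const (locallyIntegrable_log_abs_affine hε.ne' d) hc hcs hc hcs
      (Real.log u)
    rw [hnorm, mul_one, mul_one] at h
    rw [← h]
    refine abs_kernelForm_le hint hint fun x y hx hy => ?_
    have hx' := hsupp hx
    have hy' := hsupp hy
    have hxy : |ε * (x - y)| ≤ ε := by
      rw [abs_mul, abs_of_pos hε]
      refine mul_le_of_le_one_right hε.le (abs_le.2 ⟨?_, ?_⟩)
      · linarith [hx'.1, hy'.2]
      · linarith [hx'.2, hy'.1]
    exact (abs_log_abs_sub_log_le hu0 hd (hxy.trans hεu.le)).trans (by gcongr)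
  have h1 := hoff (0 - u) (by simp [abs_of_pos hu0])
  have h2 := hoff (u - 0) (by simp [abs_of_pos hu0])
  rw [hscalar, kernelForm_sub_left hlog (hg 0) (hgc 0) (hg u) (hgc u) hdiff hdiffc,
    kernelForm_sub_right hlog (hg 0) (hgc 0) (hg 0) (hgc 0) (hg u) (hgc u),
    kernelForm_sub_right hlog (hg u) (hgc u) (hg 0) (hgc 0) (hg u) (hgc u)]
  simp only [kernelForm_rescale_translate hε, sub_self, hdiag]
  set B₁ := kernelForm (fun w => Real.log |ε * w + (0 - u)|) φ φ
  set B₂ := kernelForm (fun w => Real.log |ε * w + (u - 0)|) φ φ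
  have hsplit : -(1 / (2 * π ^ 2)) * (Real.log ε - kappa φ - B₁ - (B₂ - (Real.log ε - kappa φ))) +
      1 / π ^ 2 * (Real.log ε - kappa φ - Real.log u) =
      1 / (2 * π ^ 2) * ((B₁ - Real.log u) + (B₂ - Real.log u)) := by
    field_simp
    ring
  rw [hsplit, abs_mul, abs_of_pos (by positivity)]
  calc 1 / (2 * π ^ 2) * |(B₁ - Real.log u) + (B₂ - Real.log u)|
      ≤ 1 / (2 * π ^ 2) * (2 / u * ε * (M * M) + 2 / u * ε * (M * M)) := by
        gcongr
        exact (abs_add_le _ _).trans (add_le_add h1 h2)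
    _ = 1 / (2 * π ^ 2) * (4 / u * (M * M)) * ε := by ring
    _ ≤ (1 / (2 * π ^ 2) * (4 / u * (M * M)) + 1) * ε := by
        gcongr
        linarith
end

section
/- Let 0 < u < 1. Then, as ε → 0+, ⟨f⁽²⁾_{ε,u}, f⁽²⁾_{ε,u}⟩ = −(1/(2π²))·(4·log ε − 2κ) + O(ε); precisely, there exist constants C > 0 and ε₀ > 0 (depending on φ and u) such that for all 0 < ε < ε₀ one has |⟨f⁽²⁾_{ε,u}, f⁽²⁾_{ε,u}⟩ + (1/(2π²))·(4·log ε − 2κ)| ≤ C·ε. -/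
open MeasureTheory Real Set

/-- The logarithmic energy form `∬ g(x) h(y) log|x-y| dx dy`. -/
noncomputable def logEnergy (g h : ℝ → ℝ) : ℝ :=
  ∫ x : ℝ, ∫ y : ℝ, g x * h y * Real.log |x - y|

/-- The rescaled bump `x ↦ ε⁻¹ φ((x - a)/ε)`. -/
noncomputable def scaledBump (φ : ℝ → ℝ) (ε a x : ℝ) : ℝ :=
  ε⁻¹ * φ ((x - a) / ε)

lemma locallyIntegrable_log_real : LocallyIntegrable Real.log volume := by
  rw [locallyIntegrable_iff]
  intro k hk
  obtain ⟨b, hb⟩ := hk.bddAbove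
  obtain ⟨a, ha⟩ := hk.bddBelow
  have hab : k ⊆ Icc a b := fun x hx => ⟨ha hx, hb hx⟩
  have h : IntegrableOn Real.log (Icc a b) volume := by
    rcases le_or_gt a b with h | h
    · rw [← intervalIntegrable_iff_integrableOn_Icc_of_le h]
      exact intervalIntegral.intervalIntegrable_log'
    · simp [Icc_eq_empty (not_le.mpr h)]
  exact h.mono_set hab

lemma integrable_mul_log_sub {h : ℝ → ℝ} (hc : Continuous h) (hs : HasCompactSupport h) (x : ℝ) :
    Integrable (fun y => h y * Real.log |x - y|) := by
  have h0 := hs.convolutionExists_left (ContinuousLinearMap.mul ℝ ℝ) hc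
    locallyIntegrable_log_real x
  simpa [ConvolutionExistsAt] using h0

lemma continuous_integral_mul_log_sub {h : ℝ → ℝ} (hc : Continuous h)
    (hs : HasCompactSupport h) :
    Continuous (fun x => ∫ y, h y * Real.log |x - y|) := by
  have h0 := hs.continuous_convolution_left (ContinuousLinearMap.mul ℝ ℝ) hc
    locallyIntegrable_log_real
  convert h0 using 2 with x
  simp [convolution_def]

lemma logEnergy_eq (g h : ℝ → ℝ) :
    logEnergy g h = ∫ x, g x * ∫ y, h y * Real.log |x - y| := by
  simp only [logEnergy, mul_assoc, integral_const_mul]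

lemma integrable_mul_integral_log {g h : ℝ → ℝ} (hg : Continuous g) (hgs : HasCompactSupport g)
    (hh : Continuous h) (hhs : HasCompactSupport h) :
    Integrable (fun x => g x * ∫ y, h y * Real.log |x - y|) :=
  (hg.mul (continuous_integral_mul_log_sub hh hhs)).integrable_of_hasCompactSupport
    hgs.mul_right

lemma logEnergy_sub_sub {p q : ℝ → ℝ} (hp : Continuous p) (hps : HasCompactSupport p)
    (hq : Continuous q) (hqs : HasCompactSupport q) :
    logEnergy (fun x => p x - q x) (fun x => p x - q x) =
      logEnergy p p - logEnergy p q - logEnergy q p + logEnergy q q := by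
  have inner : ∀ x, ∫ y, (p y - q y) * Real.log |x - y| =
      (∫ y, p y * Real.log |x - y|) - ∫ y, q y * Real.log |x - y| := fun x => by
    rw [← integral_sub (integrable_mul_log_sub hp hps x) (integrable_mul_log_sub hq hqs x)]
    simp only [sub_mul]
  have hpp := integrable_mul_integral_log hp hps hp hps
  have hpq := integrable_mul_integral_log hp hps hq hqs
  have hqp := integrable_mul_integral_log hq hqs hp hps
  have hqq := integrable_mul_integral_log hq hqs hq hqs
  simp only [logEnergy_eq, inner]
  rw [← integral_sub hpp hpq, ← integral_sub ?_ hqp, ← integral_add ?_ hqq]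
  rotate_left
  · exact (hpp.sub hpq).sub hqp
  · exact hpp.sub hpq
  congr 1 with x
  ring

lemma logEnergy_add_const {g h : ℝ → ℝ} (hg : Continuous g) (hgs : HasCompactSupport g)
    (hh : Continuous h) (hhs : HasCompactSupport h) (c : ℝ) :
    logEnergy g h + c * ((∫ x, g x) * ∫ y, h y) =
      ∫ x, g x * ∫ y, h y * (Real.log |x - y| + c) := by
  have inner : ∀ x, ∫ y, h y * (Real.log |x - y| + c) =
      (∫ y, h y * Real.log |x - y|) + c * ∫ y, h y := fun x => by
    rw [← integral_const_mul, ← integral_add (integrable_mul_log_sub hh hhs x)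
      ((hh.integrable_of_hasCompactSupport hhs).const_mul c)]
    congr 1 with y
    ring
  simp only [logEnergy_eq, inner]
  simp only [mul_add]
  rw [integral_add (integrable_mul_integral_log hg hgs hh hhs)
    ((hg.integrable_of_hasCompactSupport hgs).mul_const _), integral_mul_const]
  ring

lemma abs_logEnergy_add_const_le {g h : ℝ → ℝ} (hg : Continuous g) (hgs : HasCompactSupport g)
    (hh : Continuous h) (hhs : HasCompactSupport h) {c K : ℝ}
    (hK : ∀ x y, g x ≠ 0 → h y ≠ 0 → |Real.log |x - y| + c| ≤ K) :
    |logEnergy g h + c * ((∫ x, g x) * ∫ y, h y)| ≤ K * ((∫ x, |g x|) * ∫ y, |h y|) := by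
  have hgi : Integrable (fun x => |g x|) := (hg.integrable_of_hasCompactSupport hgs).abs
  have hhi : Integrable (fun y => |h y|) := (hh.integrable_of_hasCompactSupport hhs).abs
  rw [logEnergy_add_const hg hgs hh hhs, ← Real.norm_eq_abs]
  have key : ∀ x, ‖g x * ∫ y, h y * (Real.log |x - y| + c)‖ ≤
      |g x| * ((∫ y, |h y|) * K) := fun x => by
    rw [norm_mul, Real.norm_eq_abs]
    rcases eq_or_ne (g x) 0 with hx | hx
    · simp [hx]
    · refine mul_le_mul_of_nonneg_left ?_ (abs_nonneg _)
      rw [← integral_mul_const]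
      refine norm_integral_le_of_norm_le (hhi.mul_const K) (ae_of_all _ fun y => ?_)
      rw [norm_mul, Real.norm_eq_abs, Real.norm_eq_abs]
      rcases eq_or_ne (h y) 0 with hy | hy
      · simp [hy]
      · exact mul_le_mul_of_nonneg_left (hK x y hx hy) (abs_nonneg _)
  refine (norm_integral_le_of_norm_le (hgi.mul_const _) (ae_of_all _ key)).trans_eq ?_
  rw [integral_mul_const]
  ring

lemma continuous_scaledBump {φ : ℝ → ℝ} (hφ : Continuous φ) (ε a : ℝ) :
    Continuous (scaledBump φ ε a) := by
  unfold scaledBump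
  fun_prop

lemma abs_sub_lt_of_scaledBump_ne_zero {φ : ℝ → ℝ}
    (hsupp : Function.support φ ⊆ Ioo (-(1/2)) (1/2)) {ε : ℝ} (hε : 0 < ε) {a x : ℝ}
    (hx : scaledBump φ ε a x ≠ 0) : |x - a| < ε / 2 := by
  have h := hsupp (right_ne_zero_of_mul hx)
  rw [mem_Ioo, lt_div_iff₀ hε, div_lt_iff₀ hε] at h
  rw [abs_lt]
  constructor <;> linarith [h.1, h.2]

lemma hasCompactSupport_scaledBump {φ : ℝ → ℝ}
    (hsupp : Function.support φ ⊆ Ioo (-(1/2)) (1/2)) {ε : ℝ} (hε : 0 < ε) (a : ℝ) :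
    HasCompactSupport (scaledBump φ ε a) := by
  refine HasCompactSupport.of_support_subset_isCompact
    (isCompact_closedBall a (ε / 2)) fun x hx => ?_
  rw [Metric.mem_closedBall, Real.dist_eq]
  exact (abs_sub_lt_of_scaledBump_ne_zero hsupp hε hx).le

lemma integral_scaledBump_mul (φ F : ℝ → ℝ) {ε : ℝ} (hε : 0 < ε) (a : ℝ) :
    ∫ x, scaledBump φ ε a x * F x = ∫ s, φ s * F (ε * s + a) := by
  have h1 := integral_sub_right_eq_self (μ := volume)
    (fun x => ε⁻¹ * φ (x / ε) * F (x + a)) a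
  have h2 := Measure.integral_comp_mul_left
    (fun x => ε⁻¹ * φ (x / ε) * F (x + a)) ε
  simp only [sub_add_cancel, smul_eq_mul, abs_inv, abs_of_pos hε] at h1 h2
  unfold scaledBump
  rw [h1]
  have h3 : ∀ s, ε⁻¹ * φ (ε * s / ε) * F (ε * s + a) = ε⁻¹ * (φ s * F (ε * s + a)) := fun s => by
    rw [mul_div_cancel_left₀ _ hε.ne', mul_assoc]
  simp only [h3, integral_const_mul] at h2
  exact (mul_left_cancel₀ (inv_ne_zero hε.ne') h2).symm

lemma integral_scaledBump (φ : ℝ → ℝ) {ε : ℝ} (hε : 0 < ε) (a : ℝ) :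
    ∫ x, scaledBump φ ε a x = ∫ s, φ s := by
  simpa using integral_scaledBump_mul φ (fun _ => 1) hε a

lemma integral_abs_scaledBump (φ : ℝ → ℝ) {ε : ℝ} (hε : 0 < ε) (a : ℝ) :
    ∫ x, |scaledBump φ ε a x| = ∫ s, |φ s| := by
  rw [← integral_scaledBump (fun s => |φ s|) hε a]
  simp only [scaledBump, abs_mul, abs_inv, abs_of_pos hε]

lemma logEnergy_scaledBump_self {φ : ℝ → ℝ} (hφ : Continuous φ)
    (hsupp : Function.support φ ⊆ Ioo (-(1/2)) (1/2)) (hnorm : ∫ x, φ x = 1)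
    {ε : ℝ} (hε : 0 < ε) (a : ℝ) :
    logEnergy (scaledBump φ ε a) (scaledBump φ ε a) = Real.log ε - kappa φ := by
  have hc := continuous_scaledBump hφ ε a
  have hs := hasCompactSupport_scaledBump hsupp hε a
  have h := logEnergy_add_const hc hs hc hs (-Real.log ε)
  simp only [integral_scaledBump φ hε, hnorm, integral_scaledBump_mul φ _ hε] at h
  have inner : ∀ s, ∫ t, φ t * (Real.log |ε * s + a - (ε * t + a)| + -Real.log ε) =
      ∫ t, φ t * Real.log |s - t| := fun s => by
    refine integral_congr_ae ?_
    filter_upwards [Measure.ae_ne volume s] with t ht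
    have hst : |s - t| ≠ 0 := abs_ne_zero.mpr (sub_ne_zero.mpr ht.symm)
    have : ε * s + a - (ε * t + a) = ε * (s - t) := by ring
    rw [this, abs_mul, abs_of_pos hε, Real.log_mul hε.ne' hst]
    ring
  simp only [inner, ← logEnergy_eq] at h
  have hk : kappa φ = -logEnergy φ φ := rfl
  linarith

lemma abs_log_one_add_le {x : ℝ} (hx : |x| ≤ 1 / 2) : |Real.log (1 + x)| ≤ 2 * |x| := by
  obtain ⟨h1, h2⟩ := abs_le.mp hx
  have hpos : 0 < 1 + x := by linarith
  have hu : Real.log (1 + x) ≤ x := by linarith [Real.log_le_sub_one_of_pos hpos]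
  have hl : 1 - (1 + x)⁻¹ ≤ Real.log (1 + x) := Real.one_sub_inv_le_log_of_pos hpos
  have hle : -(2 * |x|) ≤ 1 - (1 + x)⁻¹ := by
    have : 1 - (1 + x)⁻¹ = x / (1 + x) := by field_simp; ring
    rw [this, le_div_iff₀ hpos]
    nlinarith [neg_abs_le x, abs_nonneg x]
  rw [abs_le]
  exact ⟨by linarith, by linarith [le_abs_self x, abs_nonneg x]⟩

lemma abs_log_abs_add_log_le {ε u x y : ℝ} (hε : 0 < ε) (hε' : ε < 1 / 4) (hu0 : 0 < u)
    (hu1 : u < 1) (hx : |x - -(1 / ε)| < ε / 2) (hy : |y - u| < ε / 2) :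
    |Real.log |y - x| + Real.log ε| ≤ 4 * ε := by
  obtain ⟨hx1, hx2⟩ := abs_lt.mp hx
  obtain ⟨hy1, hy2⟩ := abs_lt.mp hy
  obtain ⟨d, hd⟩ : ∃ d, d = y - x - 1 / ε := ⟨_, rfl⟩
  have hd2 : |d| ≤ 2 := abs_le.mpr ⟨by linarith, by linarith⟩
  have hm : ε * (y - x) = 1 + ε * d := by rw [hd]; field_simp; ring
  have hb : |ε * d| ≤ 2 * ε := by
    rw [abs_mul, abs_of_pos hε]
    nlinarith
  have hpos : 0 < y - x := by
    have : 0 < ε * (y - x) := by rw [hm]; linarith [(abs_le.mp hb).1]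
    exact pos_of_mul_pos_right this hε.le
  rw [abs_of_pos hpos, add_comm, ← Real.log_mul hε.ne' hpos.ne', hm]
  linarith [abs_log_one_add_le (x := ε * d) (by linarith)]

lemma deriv_smoothedInd_Icc_s3 {φ : ℝ → ℝ} (hφ : Continuous φ) (ε : ℝ) {a b : ℝ} (hab : a ≤ b) :
    deriv (smoothedInd φ ε (Icc a b)) =
      fun x => scaledBump φ ε a x - scaledBump φ ε b x := by
  have hc : Continuous fun w => ε⁻¹ * φ (w / ε) := by fun_prop
  have heq : smoothedInd φ ε (Icc a b) = fun x =>
      (∫ w in (0 : ℝ)..(x - a), ε⁻¹ * φ (w / ε)) - ∫ w in (0 : ℝ)..(x - b), ε⁻¹ * φ (w / ε) := by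
    ext x
    rw [intervalIntegral.integral_interval_sub_left (hc.intervalIntegrable _ _)
      (hc.intervalIntegrable _ _), intervalIntegral.integral_of_le (by linarith),
      ← integral_Icc_eq_integral_Ioc, ← integral_indicator measurableSet_Icc]
    unfold smoothedInd
    congr 1 with y
    have : x - y ∈ Icc a b ↔ y ∈ Icc (x - b) (x - a) := by
      simp only [mem_Icc]
      constructor <;> rintro ⟨h1, h2⟩ <;> constructor <;> linarith
    by_cases hy : y ∈ Icc (x - b) (x - a)
    · rw [indicator_of_mem hy, indicator_of_mem (this.mpr hy), one_mul]
    · rw [indicator_of_notMem hy, indicator_of_notMem (mt this.mp hy), zero_mul]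
  ext x
  have key : ∀ c, HasDerivAt (fun x => ∫ w in (0 : ℝ)..(x - c), ε⁻¹ * φ (w / ε))
      (scaledBump φ ε c x) x := fun c =>
    HasDerivAt.comp_sub_const x c
      (intervalIntegral.integral_hasDerivAt_right (hc.intervalIntegrable _ _)
        hc.stronglyMeasurable.stronglyMeasurableAtFilter hc.continuousAt)
  rw [heq]
  exact ((key a).sub (key b)).deriv

theorem stmt_3 (φ : ℝ → ℝ) (hφ : ContDiff ℝ (⊤ : ℕ∞) φ)
    (hsupp : Function.support φ ⊆ Set.Ioo (-(1/2)) (1/2))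
    (hnorm : ∫ x : ℝ, φ x = 1)
    (u : ℝ) (hu0 : 0 < u) (hu1 : u < 1) :
    ∃ C > 0, ∃ ε₀ > 0, ∀ ε : ℝ, 0 < ε → ε < ε₀ →
      |scalarProd (smoothedInd φ ε (Set.Icc (-(1/ε)) u)) (smoothedInd φ ε (Set.Icc (-(1/ε)) u)) +
        (1 / (2 * π ^ 2)) * (4 * Real.log ε - 2 * kappa φ)| ≤ C * ε := by
  have hcont := hφ.continuous
  obtain ⟨M, hM⟩ : ∃ M, M = ∫ s, |φ s| := ⟨_, rfl⟩
  refine ⟨1 / (2 * π ^ 2) * (8 * (M * M) + 1), ?_, 1 / 4, by norm_num, fun ε hε hε' => ?_⟩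
  · have := mul_self_nonneg M
    positivity
  have hle : -(1 / ε) ≤ u := by
    have : 0 < 1 / ε := by positivity
    linarith
  have hca := continuous_scaledBump hcont ε (-(1 / ε))
  have hsa := hasCompactSupport_scaledBump hsupp hε (-(1 / ε))
  have hcb := continuous_scaledBump hcont ε u
  have hsb := hasCompactSupport_scaledBump hsupp hε u
  have hbound := abs_logEnergy_add_const_le hca hsa hcb hsb (c := Real.log ε) (K := 4 * ε)
    fun x y hx hy => by
      rw [abs_sub_comm x y]
      exact abs_log_abs_add_log_le hε hε' hu0 hu1
        (abs_sub_lt_of_scaledBump_ne_zero hsupp hε hx)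
        (abs_sub_lt_of_scaledBump_ne_zero hsupp hε hy)
  have hbound' := abs_logEnergy_add_const_le hcb hsb hca hsa (c := Real.log ε) (K := 4 * ε)
    fun x y hx hy =>
      abs_log_abs_add_log_le hε hε' hu0 hu1
        (abs_sub_lt_of_scaledBump_ne_zero hsupp hε hy)
        (abs_sub_lt_of_scaledBump_ne_zero hsupp hε hx)
  simp only [integral_scaledBump φ hε, integral_abs_scaledBump φ hε, hnorm, ← hM, mul_one]
    at hbound hbound'
  have hsp : ∀ f, scalarProd f f = -(1 / (2 * π ^ 2)) * logEnergy (deriv f) (deriv f) :=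
    fun _ => rfl
  rw [hsp, deriv_smoothedInd_Icc_s3 hcont ε hle, logEnergy_sub_sub hca hsa hcb hsb,
    logEnergy_scaledBump_self hcont hsupp hnorm hε, logEnergy_scaledBump_self hcont hsupp hnorm hε]
  generalize logEnergy (scaledBump φ ε (-(1 / ε))) (scaledBump φ ε u) = A at *
  generalize logEnergy (scaledBump φ ε u) (scaledBump φ ε (-(1 / ε))) = B at *
  have hrw : -(1 / (2 * π ^ 2)) * (Real.log ε - kappa φ - A - B + (Real.log ε - kappa φ)) +
      1 / (2 * π ^ 2) * (4 * Real.log ε - 2 * kappa φ) =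
      1 / (2 * π ^ 2) * ((A + Real.log ε) + (B + Real.log ε)) := by ring
  rw [hrw, abs_mul, abs_of_nonneg (by positivity : (0 : ℝ) ≤ 1 / (2 * π ^ 2)), mul_assoc]
  refine mul_le_mul_of_nonneg_left ?_ (by positivity)
  linarith [abs_add_le (A + Real.log ε) (B + Real.log ε)]
end

section
/- Let τ > 0, b₀, b₁, b₂ > 0, and let q be real with q > −b₀. Then exp( ∫_0^∞ (e^{−xq} − 1) · e^{−b₀ x} · (1 − e^{−b₁ x})(1 − e^{−b₂ x}) / ( (1 − e^{−x})(1 − e^{−τ x}) ) · dx/x ) = ∏_{n₁=0}^∞ ∏_{n₂=0}^∞ [ (b₀ + n₁ + n₂τ)/(q + b₀ + n₁ + n₂τ) · (q + b₀ + b₁ + n₁ + n₂τ)/(b₀ + b₁ + n₁ + n₂τ) · (q + b₀ + b₂ + n₁ + n₂τ)/(b₀ + b₂ + n₁ + n₂τ) · (b₀ + b₁ + b₂ + n₁ + n₂τ)/(q + b₀ + b₁ + b₂ + n₁ + n₂τ) ], where the integral converges absolutely and the double infinite product converges. -/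
open MeasureTheory Real

/-- The Lévy–Khinchine integrand of the Barnes beta distribution of type (2,2). -/
noncomputable def barnesLK (τ b₀ b₁ b₂ q x : ℝ) : ℝ :=
  (Real.exp (-(x * q)) - 1) * Real.exp (-(b₀ * x)) *
    ((1 - Real.exp (-(b₁ * x))) * (1 - Real.exp (-(b₂ * x)))) /
      ((1 - Real.exp (-x)) * (1 - Real.exp (-(τ * x)))) / x

/-- The factor of the infinite product over the lattice point n₁ + n₂ τ. -/
noncomputable def barnesFactor (τ b₀ b₁ b₂ q : ℝ) (p : ℕ × ℕ) : ℝ :=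
  ((b₀ + p.1 + p.2 * τ) / (q + b₀ + p.1 + p.2 * τ)) *
    ((q + b₀ + b₁ + p.1 + p.2 * τ) / (b₀ + b₁ + p.1 + p.2 * τ)) *
    ((q + b₀ + b₂ + p.1 + p.2 * τ) / (b₀ + b₂ + p.1 + p.2 * τ)) *
    ((b₀ + b₁ + b₂ + p.1 + p.2 * τ) / (q + b₀ + b₁ + b₂ + p.1 + p.2 * τ))

/-- The part of the Lévy–Khinchine integrand contributed by the lattice point `p.1 + p.2 * τ`. -/
noncomputable def barnesTerm (τ b₀ b₁ b₂ q : ℝ) (p : ℕ × ℕ) (x : ℝ) : ℝ :=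
  (Real.exp (-(x * q)) - 1) * Real.exp (-(b₀ * x)) *
    ((1 - Real.exp (-(b₁ * x))) * (1 - Real.exp (-(b₂ * x)))) / x *
      (Real.exp (-x) ^ p.1 * Real.exp (-(τ * x)) ^ p.2)

lemma abs_exp_neg_mul_sub_exp_neg_mul_le (a b : ℝ) {x : ℝ} (hx : 0 ≤ x) :
    |Real.exp (-(a * x)) - Real.exp (-(b * x))| ≤
      |a - b| * x * Real.exp (-(min a b * x)) := by
  wlog hab : a ≤ b generalizing a b
  · rw [abs_sub_comm, abs_sub_comm a b, min_comm]
    exact this b a (le_of_not_ge hab)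
  have h1 : Real.exp (-(b * x)) = Real.exp (-(a * x)) * Real.exp (-((b - a) * x)) := by
    rw [← Real.exp_add]; ring_nf
  have h2 := Real.add_one_le_exp (-((b - a) * x))
  have h3 : Real.exp (-(b * x)) ≤ Real.exp (-(a * x)) :=
    Real.exp_le_exp.2 (by nlinarith)
  rw [min_eq_left hab, abs_of_nonneg (sub_nonneg.2 h3), abs_sub_comm,
    abs_of_nonneg (sub_nonneg.2 hab), h1]
  nlinarith [Real.exp_pos (-(a * x))]

lemma abs_inv_mul_exp_neg_mul_sub_le (a b : ℝ) {x : ℝ} (hx : 0 < x) :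
    |x⁻¹ * (Real.exp (-(a * x)) - Real.exp (-(b * x)))| ≤
      |a - b| * Real.exp (-(min a b) * x) := by
  rw [abs_mul, abs_of_pos (inv_pos.2 hx), inv_mul_le_iff₀ hx, neg_mul]
  linarith [abs_exp_neg_mul_sub_exp_neg_mul_le a b hx.le]

lemma one_sub_exp_neg_mul_le {a b x : ℝ} (ha : 0 < a) (hx : 0 ≤ x) :
    1 - Real.exp (-(b * x)) ≤ max 1 (b / a) * (1 - Real.exp (-(a * x))) := by
  have h := one_add_mul_self_le_rpow_one_add (s := Real.exp (-(a * x)) - 1)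
    (by linarith [Real.exp_pos (-(a * x))]) (le_max_left 1 (b / a))
  rw [add_sub_cancel, ← Real.exp_mul] at h
  have h' : Real.exp (-(a * x) * max 1 (b / a)) ≤ Real.exp (-(b * x)) := by
    refine Real.exp_le_exp.2 ?_
    have := (div_le_iff₀ ha).1 (le_max_right 1 (b / a))
    nlinarith
  linarith

lemma integrableOn_inv_mul_exp_neg_mul_sub {a b : ℝ} (ha : 0 < a) (hb : 0 < b) :
    IntegrableOn (fun x ↦ x⁻¹ * (Real.exp (-(a * x)) - Real.exp (-(b * x)))) (Set.Ioi 0) := by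
  refine Integrable.mono' ((exp_neg_integrableOn_Ioi 0 (lt_min ha hb)).const_mul |a - b|)
    (by fun_prop) ?_
  filter_upwards [ae_restrict_mem measurableSet_Ioi] with x hx
  exact abs_inv_mul_exp_neg_mul_sub_le a b hx

lemma integral_inv_mul_exp_neg_mul_sub {a b : ℝ} (ha : 0 < a) (hb : 0 < b) :
    ∫ x in Set.Ioi 0, x⁻¹ * (Real.exp (-(a * x)) - Real.exp (-(b * x))) =
      Real.log b - Real.log a := by
  have hc : Continuous fun x : ℝ ↦ Real.exp (-x) := by fun_prop
  have h := Frullani.integral_Ioi_eq (f := fun x ↦ Real.exp (-x)) (L := 1) (R := 0)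
    (hc.locallyIntegrable.locallyIntegrableOn _) ha hb
    (by simpa using (hc.tendsto 0).mono_left nhdsWithin_le_nhds)
    Real.tendsto_exp_neg_atTop_nhds_zero
    (integrableOn_inv_mul_exp_neg_mul_sub ha hb)
  simpa [Real.log_div hb.ne' ha.ne'] using h

lemma barnesLK_eq (τ b₀ b₁ b₂ q x : ℝ) :
    barnesLK τ b₀ b₁ b₂ q x = (Real.exp (-(x * q)) - 1) * Real.exp (-(b₀ * x)) *
      ((1 - Real.exp (-(b₁ * x))) * (1 - Real.exp (-(b₂ * x)))) / x *
      ((1 - Real.exp (-x))⁻¹ * (1 - Real.exp (-(τ * x)))⁻¹) := by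
  rw [barnesLK, div_right_comm, div_eq_mul_inv _ (_ * _), mul_inv]

lemma integrableOn_barnesLK {τ b₀ b₁ b₂ q : ℝ} (hτ : 0 < τ) (hb₀ : 0 < b₀) (hb₁ : 0 < b₁)
    (hb₂ : 0 < b₂) (hq : -b₀ < q) :
    IntegrableOn (barnesLK τ b₀ b₁ b₂ q) (Set.Ioi 0) := by
  have hq' : 0 < q + b₀ := by linarith
  refine Integrable.mono' ((exp_neg_integrableOn_Ioi 0 (lt_min hq' hb₀)).const_mul
    (|q + b₀ - b₀| * (max 1 (b₁ / 1) * max 1 (b₂ / τ))))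
    (Measurable.aestronglyMeasurable (by unfold barnesLK; fun_prop)) ?_
  filter_upwards [ae_restrict_mem measurableSet_Ioi] with x (hx : 0 < x)
  have pos : ∀ {c : ℝ}, 0 < c → 0 < 1 - Real.exp (-(c * x)) := fun {c} hc ↦
    sub_pos.2 (Real.exp_lt_one_iff.2 (by have := mul_pos hc hx; linarith))
  have p0 := pos one_pos
  have pτ := pos hτ
  have p1 := pos hb₁
  have p2 := pos hb₂
  have e1 := (div_le_iff₀ p0).2 (one_sub_exp_neg_mul_le (b := b₁) one_pos hx.le)
  have e2 := (div_le_iff₀ pτ).2 (one_sub_exp_neg_mul_le (b := b₂) hτ hx.le)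
  have e3 := abs_inv_mul_exp_neg_mul_sub_le (q + b₀) b₀ hx
  have key : barnesLK τ b₀ b₁ b₂ q x =
      x⁻¹ * (Real.exp (-((q + b₀) * x)) - Real.exp (-(b₀ * x))) *
        ((1 - Real.exp (-(b₁ * x))) / (1 - Real.exp (-(1 * x))) *
          ((1 - Real.exp (-(b₂ * x))) / (1 - Real.exp (-(τ * x))))) := by
    have : Real.exp (-((q + b₀) * x)) = Real.exp (-(x * q)) * Real.exp (-(b₀ * x)) := by
      rw [← Real.exp_add]; ring_nf
    rw [barnesLK_eq, this, one_mul]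
    ring
  rw [key, Real.norm_eq_abs, abs_mul, abs_of_pos (mul_pos (div_pos p1 p0) (div_pos p2 pτ))]
  calc _ ≤ |q + b₀ - b₀| * Real.exp (-(min (q + b₀) b₀) * x) *
        (max 1 (b₁ / 1) * max 1 (b₂ / τ)) := by gcongr
    _ = _ := by ring

lemma hasSum_geometric_mul_geometric {r s : ℝ} (hr₀ : 0 ≤ r) (hr : r < 1) (hs₀ : 0 ≤ s)
    (hs : s < 1) :
    HasSum (fun p : ℕ × ℕ ↦ r ^ p.1 * s ^ p.2) ((1 - r)⁻¹ * (1 - s)⁻¹) :=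
  (hasSum_geometric_of_lt_one hr₀ hr).mul (hasSum_geometric_of_lt_one hs₀ hs)
    ((summable_geometric_of_lt_one hr₀ hr).mul_of_nonneg (summable_geometric_of_lt_one hs₀ hs)
      (fun _ ↦ by positivity) fun _ ↦ by positivity)

lemma hasSum_barnesTerm {τ x : ℝ} (b₀ b₁ b₂ q : ℝ) (hτ : 0 < τ) (hx : 0 < x) :
    HasSum (fun p ↦ barnesTerm τ b₀ b₁ b₂ q p x) (barnesLK τ b₀ b₁ b₂ q x) := by
  have h := hasSum_geometric_mul_geometric (Real.exp_pos (-x)).le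
    (Real.exp_lt_one_iff.2 (by linarith)) (Real.exp_pos (-(τ * x))).le
    (Real.exp_lt_one_iff.2 (by have := mul_pos hτ hx; linarith))
  rw [barnesLK_eq]
  exact h.mul_left _

lemma hasSum_norm_barnesTerm {τ x : ℝ} (b₀ b₁ b₂ q : ℝ) (hτ : 0 < τ) (hx : 0 < x) :
    HasSum (fun p ↦ ‖barnesTerm τ b₀ b₁ b₂ q p x‖) ‖barnesLK τ b₀ b₁ b₂ q x‖ := by
  have h := hasSum_geometric_mul_geometric (Real.exp_pos (-x)).le
    (Real.exp_lt_one_iff.2 (by linarith)) (Real.exp_pos (-(τ * x))).le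
    (Real.exp_lt_one_iff.2 (by have := mul_pos hτ hx; linarith))
  have hn : ∀ p : ℕ × ℕ, ‖Real.exp (-x) ^ p.1 * Real.exp (-(τ * x)) ^ p.2‖ =
      Real.exp (-x) ^ p.1 * Real.exp (-(τ * x)) ^ p.2 :=
    fun p ↦ Real.norm_of_nonneg (by positivity)
  rw [barnesLK_eq, norm_mul, Real.norm_of_nonneg (h.nonneg fun p ↦ by positivity)]
  simp only [barnesTerm, norm_mul _ (_ ^ _ * _), hn]
  exact h.mul_left _

lemma barnesTerm_eq (τ b₀ b₁ b₂ q : ℝ) (p : ℕ × ℕ) (x : ℝ) :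
    barnesTerm τ b₀ b₁ b₂ q p x =
      x⁻¹ * (Real.exp (-((q + b₀ + p.1 + p.2 * τ) * x)) -
        Real.exp (-((b₀ + p.1 + p.2 * τ) * x))) -
      x⁻¹ * (Real.exp (-((q + b₀ + b₁ + p.1 + p.2 * τ) * x)) -
        Real.exp (-((b₀ + b₁ + p.1 + p.2 * τ) * x))) -
      x⁻¹ * (Real.exp (-((q + b₀ + b₂ + p.1 + p.2 * τ) * x)) -
        Real.exp (-((b₀ + b₂ + p.1 + p.2 * τ) * x))) +
      x⁻¹ * (Real.exp (-((q + b₀ + b₁ + b₂ + p.1 + p.2 * τ) * x)) -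
        Real.exp (-((b₀ + b₁ + b₂ + p.1 + p.2 * τ) * x))) := by
  have hn : Real.exp (-x) ^ p.1 = Real.exp (-(p.1 * x)) := by
    rw [← Real.exp_nat_mul]; ring_nf
  have hm : Real.exp (-(τ * x)) ^ p.2 = Real.exp (-(p.2 * τ * x)) := by
    rw [← Real.exp_nat_mul]; ring_nf
  simp only [barnesTerm, hn, hm, add_mul, neg_add, Real.exp_add, mul_comm x q]
  ring

lemma barnesFactor_pos {τ b₀ b₁ b₂ q : ℝ} (hτ : 0 < τ) (hb₀ : 0 < b₀) (hb₁ : 0 < b₁)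
    (hb₂ : 0 < b₂) (hq : -b₀ < q) (p : ℕ × ℕ) :
    0 < barnesFactor τ b₀ b₁ b₂ q p := by
  have hq' : 0 < q + b₀ := by linarith
  unfold barnesFactor
  positivity

lemma integrableOn_barnesTerm_and_integral_eq {τ b₀ b₁ b₂ q : ℝ} (hτ : 0 < τ) (hb₀ : 0 < b₀) (hb₁ : 0 < b₁)
    (hb₂ : 0 < b₂) (hq : -b₀ < q) (p : ℕ × ℕ) :
    IntegrableOn (barnesTerm τ b₀ b₁ b₂ q p) (Set.Ioi 0) ∧
      ∫ x in Set.Ioi 0, barnesTerm τ b₀ b₁ b₂ q p x =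
        Real.log (barnesFactor τ b₀ b₁ b₂ q p) := by
  have hq' : 0 < q + b₀ := by linarith
  have h₁ := integrableOn_inv_mul_exp_neg_mul_sub
    (by positivity : 0 < q + b₀ + p.1 + p.2 * τ) (by positivity : 0 < b₀ + p.1 + p.2 * τ)
  have h₂ := integrableOn_inv_mul_exp_neg_mul_sub
    (by positivity : 0 < q + b₀ + b₁ + p.1 + p.2 * τ)
    (by positivity : 0 < b₀ + b₁ + p.1 + p.2 * τ)
  have h₃ := integrableOn_inv_mul_exp_neg_mul_sub
    (by positivity : 0 < q + b₀ + b₂ + p.1 + p.2 * τ)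
    (by positivity : 0 < b₀ + b₂ + p.1 + p.2 * τ)
  have h₄ := integrableOn_inv_mul_exp_neg_mul_sub
    (by positivity : 0 < q + b₀ + b₁ + b₂ + p.1 + p.2 * τ)
    (by positivity : 0 < b₀ + b₁ + b₂ + p.1 + p.2 * τ)
  rw [funext (barnesTerm_eq τ b₀ b₁ b₂ q p)]
  refine ⟨((h₁.sub h₂).sub h₃).add h₄, ?_⟩
  beta_reduce
  rw [integral_add (by exact (h₁.sub h₂).sub h₃) h₄, integral_sub (by exact h₁.sub h₂) h₃,
    integral_sub h₁ h₂]
  repeat rw [integral_inv_mul_exp_neg_mul_sub (by positivity) (by positivity)]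
  rw [barnesFactor, Real.log_mul (by positivity) (by positivity),
    Real.log_mul (by positivity) (by positivity), Real.log_mul (by positivity) (by positivity),
    Real.log_div (by positivity) (by positivity), Real.log_div (by positivity) (by positivity),
    Real.log_div (by positivity) (by positivity), Real.log_div (by positivity) (by positivity)]
  ring

theorem stmt_14 (τ b₀ b₁ b₂ q : ℝ) (hτ : 0 < τ) (hb₀ : 0 < b₀) (hb₁ : 0 < b₁) (hb₂ : 0 < b₂)
    (hq : -b₀ < q) :
    IntegrableOn (barnesLK τ b₀ b₁ b₂ q) (Set.Ioi 0) volume ∧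
    Multipliable (barnesFactor τ b₀ b₁ b₂ q) ∧
    Real.exp (∫ x in Set.Ioi 0, barnesLK τ b₀ b₁ b₂ q x) =
      ∏' p : ℕ × ℕ, barnesFactor τ b₀ b₁ b₂ q p := by
  have hLK := integrableOn_barnesLK hτ hb₀ hb₁ hb₂ hq
  have hterm p := integrableOn_barnesTerm_and_integral_eq hτ hb₀ hb₁ hb₂ hq p
  have hsum : Summable fun p ↦ ∫ x in Set.Ioi 0, ‖barnesTerm τ b₀ b₁ b₂ q p x‖ := by
    refine summable_of_sum_le (c := ∫ x in Set.Ioi 0, ‖barnesLK τ b₀ b₁ b₂ q x‖)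
      (fun p ↦ integral_nonneg fun x ↦ norm_nonneg _) fun s ↦ ?_
    rw [← integral_finsetSum s fun p _ ↦ (hterm p).1.norm]
    refine setIntegral_mono_on (integrable_finsetSum s fun p _ ↦ (hterm p).1.norm) hLK.norm
      measurableSet_Ioi fun x hx ↦ ?_
    exact sum_le_hasSum s (fun p _ ↦ norm_nonneg _) (hasSum_norm_barnesTerm b₀ b₁ b₂ q hτ hx)
  have hlog := hasSum_integral_of_summable_integral_norm (fun p ↦ (hterm p).1) hsum
  rw [setIntegral_congr_fun measurableSet_Ioi
    fun x hx ↦ (hasSum_barnesTerm b₀ b₁ b₂ q hτ hx).tsum_eq] at hlog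
  simp only [(hterm _).2] at hlog
  have hprod := Real.hasProd_of_hasSum_log (barnesFactor_pos hτ hb₀ hb₁ hb₂ hq) hlog
  exact ⟨hLK, hprod.multipliable, hprod.tprod_eq.symm⟩
end
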